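/- The Levi-Civita covariant derivative of the Riemannian Ricci tensor of the pp-metric vanishes identically, i.e. ∂_μ {Ric}_{νλ} − {Γ}^η_{μν} {Ric}_{ηλ} − {Γ}^η_{μλ} {Ric}_{νη} = 0 for all μ, ν, λ, if and only if ∂₁²f + ∂₂²f is a constant function on ℝ⁴. -/

import Mathlib

noncomputable section

open scoped BigOperators

/-- Points of spacetime: ℝ⁴ with coordinates x⁰, x¹, x², x³. -/
abbrev Spacetime := Fin 4 → ℝ

/-- Partial derivative ∂_μ of a scalar function. -/
def pd (μ : Fin 4) (h : Spacetime → ℝ) : Spacetime → ℝ :=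
  fun x => fderiv ℝ h x (Pi.single μ 1)

/-- The pp-metric g_{μν}: nonzero components g₀₃ = g₃₀ = 1, g₁₁ = g₂₂ = −1, g₃₃ = f. -/
def ppMetric (f : Spacetime → ℝ) (x : Spacetime) (μ ν : Fin 4) : ℝ :=
  if μ = 0 ∧ ν = 3 then 1 else if μ = 3 ∧ ν = 0 then 1
  else if μ = 1 ∧ ν = 1 then -1 else if μ = 2 ∧ ν = 2 then -1
  else if μ = 3 ∧ ν = 3 then f x else 0

/-- The pointwise inverse metric g^{μν}: g⁰⁰ = −f, g⁰³ = g³⁰ = 1, g¹¹ = g²² = −1. -/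
def ppMetricInv (f : Spacetime → ℝ) (x : Spacetime) (μ ν : Fin 4) : ℝ :=
  if μ = 0 ∧ ν = 0 then -(f x) else if μ = 0 ∧ ν = 3 then 1
  else if μ = 3 ∧ ν = 0 then 1
  else if μ = 1 ∧ ν = 1 then -1 else if μ = 2 ∧ ν = 2 then -1 else 0

/-- Christoffel symbols {Γ}^λ_{μν} = ½ g^{λκ}(∂_μ g_{κν} + ∂_ν g_{κμ} − ∂_κ g_{μν}). -/
def christoffel (f : Spacetime → ℝ) (x : Spacetime) (l μ ν : Fin 4) : ℝ :=
  (1/2) * ∑ κ, ppMetricInv f x l κ *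
    (pd μ (fun y => ppMetric f y κ ν) x + pd ν (fun y => ppMetric f y κ μ) x
      - pd κ (fun y => ppMetric f y μ ν) x)

/-- Totally antisymmetric symbol ε with ε₀₁₂₃ = 1. -/
def eps (a b c d : Fin 4) : ℝ :=
  ((((b:ℕ):ℝ) - ((a:ℕ):ℝ)) * (((c:ℕ):ℝ) - ((a:ℕ):ℝ)) * (((d:ℕ):ℝ) - ((a:ℕ):ℝ)) *
    (((c:ℕ):ℝ) - ((b:ℕ):ℝ)) * (((d:ℕ):ℝ) - ((b:ℕ):ℝ)) * (((d:ℕ):ℝ) - ((c:ℕ):ℝ))) / 12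

/-- Purely axial torsion T_{κμν} = k(x³) ε_{0κμν}. -/
def torsion (k : ℝ → ℝ) (x : Spacetime) (κ μ ν : Fin 4) : ℝ :=
  k (x 3) * eps 0 κ μ ν

/-- Contorsion K^κ_{μν} = ½ g^{κρ} T_{ρμν}. -/
def contorsion (f : Spacetime → ℝ) (k : ℝ → ℝ) (x : Spacetime) (κ μ ν : Fin 4) : ℝ :=
  (1/2) * ∑ ρ, ppMetricInv f x κ ρ * torsion k x ρ μ ν

/-- The full connection Γ^λ_{μν} = {Γ}^λ_{μν} + K^λ_{μν}. -/
def fullConn (f : Spacetime → ℝ) (k : ℝ → ℝ) (x : Spacetime) (κ μ ν : Fin 4) : ℝ :=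
  christoffel f x κ μ ν + contorsion f k x κ μ ν

/-- Curvature R[A]^κ_{λμν} of connection coefficients A^κ_{μν}. -/
def curv (A : Spacetime → Fin 4 → Fin 4 → Fin 4 → ℝ) (x : Spacetime)
    (κ l μ ν : Fin 4) : ℝ :=
  pd μ (fun y => A y κ ν l) x - pd ν (fun y => A y κ μ l) x
    + ∑ η, (A x κ μ η * A x η ν l - A x κ ν η * A x η μ l)

/-- The parallel null vector field l^μ = (1,0,0,0). -/
def lUp : Fin 4 → ℝ := fun μ => if μ = 0 then 1 else 0

/-- The lowered vector l_μ = g_{μν} l^ν = (0,0,0,1). -/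
def lCov : Fin 4 → ℝ := fun μ => if μ = 3 then 1 else 0

/-- Ricci curvature of the Levi-Civita connection: {Ric}_{λν} = R[{Γ}]^μ_{λμν}. -/
def RicLC (f : Spacetime → ℝ) (x : Spacetime) (lam ν : Fin 4) : ℝ :=
  ∑ μ, curv (christoffel f) x μ lam μ ν

lemma pd_const (μ : Fin 4) (c : ℝ) (x : Spacetime) : pd μ (fun _ => c) x = 0 := by
  simp [pd]

lemma pd_const_mul (μ : Fin 4) (c : ℝ) (h : Spacetime → ℝ) (x : Spacetime) :
    pd μ (fun y => c * h y) x = c * pd μ h x := by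
  change fderiv ℝ (c • h) x _ = _
  simp [pd, fderiv_const_smul_field]

lemma contDiff_pd {h : Spacetime → ℝ} (hh : ContDiff ℝ (⊤ : ℕ∞) h) (μ : Fin 4) :
    ContDiff ℝ (⊤ : ℕ∞) (pd μ h) :=
  (hh.fderiv_right (m := (⊤ : ℕ∞)) (by simp)).clm_apply contDiff_const

/-- Partial derivatives of a smooth function commute. -/
lemma pd_comm {h : Spacetime → ℝ} (hh : ContDiff ℝ (⊤ : ℕ∞) h) (μ ν : Fin 4) (x : Spacetime) :
    pd μ (pd ν h) x = pd ν (pd μ h) x := by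
  have hd : DifferentiableAt ℝ (fderiv ℝ h) x :=
    ((hh.fderiv_right (m := (⊤ : ℕ∞)) (by simp)).differentiable (by simp)).differentiableAt
  have hpd (a b : Fin 4) :
      pd a (pd b h) x = fderiv ℝ (fderiv ℝ h) x (Pi.single a 1) (Pi.single b 1) := by
    unfold pd
    rw [fderiv_clm_apply hd (differentiableAt_const _)]
    simp
  have hsymm : IsSymmSndFDerivAt ℝ h x :=
    hh.contDiffAt.isSymmSndFDerivAt
      (by simpa using WithTop.coe_le_coe.2 (le_top : (2 : ℕ∞) ≤ ⊤))
  rw [hpd, hpd, hsymm.eq]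

/-- A differentiable function on spacetime with vanishing partial derivatives is constant. -/
lemma eq_of_pd_eq_zero {h : Spacetime → ℝ} (hh : Differentiable ℝ h)
    (hz : ∀ μ x, pd μ h x = 0) (x y : Spacetime) : h x = h y := by
  refine is_const_of_fderiv_eq_zero (𝕜 := ℝ) hh (fun z => ?_) x y
  refine ContinuousLinearMap.coe_injective ((Pi.basisFun ℝ (Fin 4)).ext fun μ => ?_)
  simpa [pd] using hz μ z

lemma pd_ppMetric (f : Spacetime → ℝ) (κ μ ν : Fin 4) (x : Spacetime) :
    pd κ (fun y => ppMetric f y μ ν) x = if μ = 3 ∧ ν = 3 then pd κ f x else 0 := by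
  fin_cases μ <;> fin_cases ν <;> simp [ppMetric, pd_const]

/-- The Christoffel symbols of the pp-metric: only `Γ⁰_{μ3} = Γ⁰_{3μ} = ½ ∂_μ f`,
`Γ¹₃₃ = ½ ∂₁ f` and `Γ²₃₃ = ½ ∂₂ f` can be nonzero. -/
lemma christoffel_eq {f : Spacetime → ℝ} (h0 : ∀ x, pd 0 f x = 0) (x : Spacetime)
    (l μ ν : Fin 4) :
    christoffel f x l μ ν =
      if l = 0 then
        if μ = 3 then 1 / 2 * pd ν f x else if ν = 3 then 1 / 2 * pd μ f x else 0
      else if (l = 1 ∨ l = 2) ∧ μ = 3 ∧ ν = 3 then 1 / 2 * pd l f x else 0 := by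
  fin_cases l <;> fin_cases μ <;> fin_cases ν <;>
    simp [christoffel, pd_ppMetric, Fin.sum_univ_four, ppMetricInv, h0]

/-- The only nonzero component of the Ricci tensor of the pp-metric is
`Ric₃₃ = ½ (∂₁²f + ∂₂²f)`. -/
lemma ricLC_eq {f : Spacetime → ℝ} (hf : ContDiff ℝ (⊤ : ℕ∞) f) (h0 : ∀ x, pd 0 f x = 0)
    (x : Spacetime) (l ν : Fin 4) :
    RicLC f x l ν =
      if l = 3 ∧ ν = 3 then 1 / 2 * (pd 1 (pd 1 f) x + pd 2 (pd 2 f) x) else 0 := by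
  have hz (μ : Fin 4) : pd 0 (pd μ f) x = 0 := by
    rw [pd_comm hf, funext h0, pd_const]
  fin_cases l <;> fin_cases ν <;>
    simp [RicLC, curv, christoffel_eq h0, Fin.sum_univ_four, h0, hz, pd_const, pd_const_mul]
  ring

/-- {∇}{Ric} = 0 iff ∂₁²f + ∂₂²f is constant. -/
theorem pp_wave_parallel_ricci_iff
    (f : Spacetime → ℝ) (hf : ContDiff ℝ (⊤ : ℕ∞) f) (h0 : ∀ x, pd 0 f x = 0) :
    (∀ (x : Spacetime) (μ ν lam : Fin 4),
      pd μ (fun y => RicLC f y ν lam) x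
        - ∑ η, christoffel f x η μ ν * RicLC f x η lam
        - ∑ η, christoffel f x η μ lam * RicLC f x ν η = 0)
    ↔ ∃ C : ℝ, ∀ x : Spacetime, pd 1 (pd 1 f) x + pd 2 (pd 2 f) x = C := by
  have hsmooth : ContDiff ℝ (⊤ : ℕ∞) (fun x => pd 1 (pd 1 f) x + pd 2 (pd 2 f) x) :=
    (contDiff_pd (contDiff_pd hf 1) 1).add (contDiff_pd (contDiff_pd hf 2) 2)
  have hcov (x : Spacetime) (μ ν lam : Fin 4) :
      pd μ (fun y => RicLC f y ν lam) x
        - ∑ η, christoffel f x η μ ν * RicLC f x η lam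
        - ∑ η, christoffel f x η μ lam * RicLC f x ν η
      = if ν = 3 ∧ lam = 3 then
          1 / 2 * pd μ (fun x => pd 1 (pd 1 f) x + pd 2 (pd 2 f) x) x else 0 := by
    have hΓ : ∀ η, christoffel f x 3 μ η = 0 := by simp [christoffel_eq h0]
    by_cases hν : ν = 3 <;> by_cases hlam : lam = 3 <;>
      simp [ricLC_eq hf h0, hν, hlam, hΓ, pd_const, pd_const_mul]
  simp only [hcov]
  constructor
  · intro h
    refine ⟨_, fun x => eq_of_pd_eq_zero (hsmooth.differentiable (by simp)) (fun μ y => ?_) x 0⟩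
    simpa using h y μ 3 3
  · rintro ⟨C, hC⟩ x μ ν lam
    simp [hC, pd_const]
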